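/- arXiv:1801.08792 — 7 statements merged into one kernel-verified Lean document; each statement's English description precedes it below -/
import Mathlib

section
/- Let 0 < κ_s < κ_t and K ∈ (0, κ_t). Define Φ_K(μ) = κ_s/(2(κ_t − Kμ)) and I(x,μ) = e^{Kx} Φ_K(μ). Suppose u is a C¹ function of (x,μ) ∈ ℝ × [−1,1] satisfying μ ∂_x u + κ_t u = (κ_s/2) ∫_{−1}^{1} u(x,μ') dμ'. Then ũ = u·I satisfies μ ∂_x ũ(x,μ) + (κ_t − Kμ) ũ(x,μ) = ∫_{−1}^{1} (κ_t − Kμ') k̃(μ',μ) ũ(x,μ') dμ', where k̃(μ',μ) = (1/2) (Φ_K(μ)/Φ_K(μ')) · κ_s/(κ_t − Kμ'). -/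
open Real Set MeasureTheory

/-- The exponential-transform importance function in slab geometry. -/
noncomputable def PhiK (κt κs K μ : ℝ) : ℝ := κs / (2 * (κt - K * μ))

/-- `I(x,μ) = e^{Kx} Φ_K(μ)`. -/
noncomputable def impI (κt κs K x μ : ℝ) : ℝ := Real.exp (K * x) * PhiK κt κs K μ

/-- The modified scattering kernel `k̃(μ',μ)`. -/
noncomputable def ktilde (κt κs K μ' μ : ℝ) : ℝ :=
  (1/2 : ℝ) * (PhiK κt κs K μ / PhiK κt κs K μ') * (κs / (κt - K * μ'))

/-- The modified cross-section `κ_t - Kμ` is positive for every direction cosine `μ`. -/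
lemma slab_cross_section_pos {κt K μ : ℝ} (hK : K ∈ Ioo (0:ℝ) κt) (hμ : μ ∈ Icc (-1:ℝ) 1) :
    0 < κt - K * μ := by
  nlinarith [hK.1, hK.2, mul_le_mul_of_nonneg_left hμ.2 hK.1.le]

/-- Importance-sampling transformation in 1D slab geometry with isotropic kernel:
if `u` solves `μ ∂_x u + κ_t u = (κ_s/2)∫ u dμ'`, then `ũ = u·I` solves the
modified equation with `κ̃_t = κ̃_s = κ_t − Kμ` and kernel `k̃`. -/
theorem slab_importance_sampling
    (κt κs K : ℝ) (hκs : 0 < κs) (hκ : κs < κt) (hK : K ∈ Ioo (0:ℝ) κt)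
    (u ux : ℝ → ℝ → ℝ)
    (hu_cont : ContinuousOn (fun p : ℝ × ℝ => u p.1 p.2) (univ ×ˢ Icc (-1) 1))
    (hux : ∀ (x : ℝ), ∀ μ ∈ Icc (-1:ℝ) 1, HasDerivAt (fun x' => u x' μ) (ux x μ) x)
    (hPDE : ∀ (x : ℝ), ∀ μ ∈ Icc (-1:ℝ) 1,
      μ * ux x μ + κt * u x μ = (κs / 2) * ∫ μ' in (-1:ℝ)..1, u x μ') :
    ∀ (x : ℝ), ∀ μ ∈ Icc (-1:ℝ) 1,
      ∃ D : ℝ, HasDerivAt (fun x' => u x' μ * impI κt κs K x' μ) D x ∧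
        μ * D + (κt - K * μ) * (u x μ * impI κt κs K x μ)
          = ∫ μ' in (-1:ℝ)..1,
              (κt - K * μ') * ktilde κt κs K μ' μ * (u x μ' * impI κt κs K x μ') := by
  intro x μ hμ
  have hI : HasDerivAt (fun x' => impI κt κs K x' μ) (K * impI κt κs K x μ) x := by
    have h := (((hasDerivAt_id x).const_mul K).exp).mul_const (PhiK κt κs K μ)
    refine h.congr_deriv ?_
    simp only [impI, id]
    ring
  refine ⟨_, (hux x μ hμ).mul hI, ?_⟩
  have hint : (∫ μ' in (-1:ℝ)..1,
      (κt - K * μ') * ktilde κt κs K μ' μ * (u x μ' * impI κt κs K x μ'))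
      = ∫ μ' in (-1:ℝ)..1, (impI κt κs K x μ * (κs / 2)) * u x μ' := by
    refine intervalIntegral.integral_congr fun μ' hμ' => ?_
    rw [uIcc_of_le (by norm_num)] at hμ'
    have hne := (slab_cross_section_pos hK hμ').ne'
    have hΦ : PhiK κt κs K μ' ≠ 0 := div_ne_zero hκs.ne' (mul_ne_zero two_ne_zero hne)
    simp only [ktilde, impI]
    field_simp
  rw [hint, intervalIntegral.integral_const_mul]
  linear_combination impI κt κs K x μ * hPDE x μ hμ
end

section
/- Let 0 < R0 < r and κ_t ∈ ℝ, and set μ_d(r) = −√(1 − R0²/r²). Then ∫_{−1}^{μ_d(r)} exp(κ_t(rμ + √(r²μ² − r² + R0²))) dμ = (1/(2r)) ∫_{R0−r}^{−√(r²−R0²)} e^{κ_t θ} (1 + (R0² − r²)/θ²) dθ. -/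
open Real Set MeasureTheory

/-- On `[-√c, 0)`, the map `θ ↦ rμ + √(r²μ² - c)` inverts `θ ↦ μ = (θ + c / θ) / (2r)`. -/
lemma mul_add_sqrt_eq_of_mem {r c θ : ℝ} (hr : r ≠ 0) (hc : 0 ≤ c) (hθ : -√c ≤ θ) (hθ0 : θ < 0) :
    r * ((θ + c / θ) / (2 * r)) + √(r ^ 2 * ((θ + c / θ) / (2 * r)) ^ 2 - c) = θ := by
  have hθ_ne := hθ0.ne
  have hsq : θ ^ 2 ≤ c := by nlinarith [Real.sq_sqrt hc, Real.sqrt_nonneg c]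
  have hnonneg : 0 ≤ (θ - c / θ) / 2 := by
    have : θ - c / θ = (θ ^ 2 - c) / θ := by field_simp
    rw [this]
    exact div_nonneg (div_nonneg_of_nonpos (by linarith) hθ0.le) (by norm_num)
  have hroot : r ^ 2 * ((θ + c / θ) / (2 * r)) ^ 2 - c = ((θ - c / θ) / 2) ^ 2 := by
    field_simp
    ring
  rw [hroot, Real.sqrt_sq hnonneg]
  field_simp
  ring

lemma hasDerivAt_add_div_div_two_mul (r c : ℝ) {θ : ℝ} (hθ : θ ≠ 0) :
    HasDerivAt (fun θ => (θ + c / θ) / (2 * r)) ((1 - c / θ ^ 2) / (2 * r)) θ := by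
  have h := ((hasDerivAt_id θ).add ((hasDerivAt_inv hθ).const_mul c)).div_const (2 * r)
  convert! h using 1
  ring

/-- Substitution `θ = rμ + √(r²μ² − r² + R0²)` in the boundary term `I_0` of the
integral equation for the importance function. -/
theorem I0_substitution
    (R0 r κt : ℝ) (hR0 : 0 < R0) (hr : R0 < r) :
    ∫ μ in (-1:ℝ)..(-Real.sqrt (1 - R0^2 / r^2)),
        Real.exp (κt * (r * μ + Real.sqrt (r^2 * μ^2 - r^2 + R0^2)))
      = (1 / (2 * r)) * ∫ θ in (R0 - r)..(-Real.sqrt (r^2 - R0^2)),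
          Real.exp (κt * θ) * (1 + (R0^2 - r^2) / θ^2) := by
  have hr0 : 0 < r := hR0.trans hr
  set c := r ^ 2 - R0 ^ 2 with hc_def
  have hc : 0 < c := by nlinarith
  have hs : 0 < √c := Real.sqrt_pos.mpr hc
  have hss : √c ^ 2 = c := Real.sq_sqrt hc.le
  have hle : -√c ≤ R0 - r := by nlinarith
  have hneg : ∀ θ ∈ uIcc (R0 - r) (-√c), -√c ≤ θ ∧ θ < 0 := by
    intro θ hθ
    rw [uIcc_of_ge hle] at hθ
    exact ⟨hθ.1, by linarith [hθ.2]⟩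
  have hleft : (R0 - r + c / (R0 - r)) / (2 * r) = -1 := by
    have : R0 - r ≠ 0 := by linarith
    rw [hc_def]
    field_simp
    ring
  have hright : (-√c + c / -√c) / (2 * r) = -√(1 - R0 ^ 2 / r ^ 2) := by
    have h : 1 - R0 ^ 2 / r ^ 2 = c / r ^ 2 := by
      rw [hc_def]
      field_simp
    rw [h, Real.sqrt_div hc.le, Real.sqrt_sq hr0.le, div_neg, Real.div_sqrt]
    field_simp
    ring
  have hsub := intervalIntegral.integral_comp_mul_deriv (a := R0 - r) (b := -√c)
    (g := fun μ => Real.exp (κt * (r * μ + √(r ^ 2 * μ ^ 2 - c))))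
    (fun θ hθ => hasDerivAt_add_div_div_two_mul r c (hneg θ hθ).2.ne)
    (by
      refine ContinuousOn.div_const (continuousOn_const.sub (continuousOn_const.div
        (by fun_prop) fun θ hθ => pow_ne_zero 2 (hneg θ hθ).2.ne)) _)
    (by fun_prop)
  rw [hleft, hright] at hsub
  have hrad : ∀ μ : ℝ, r ^ 2 * μ ^ 2 - r ^ 2 + R0 ^ 2 = r ^ 2 * μ ^ 2 - c := fun μ => by
    rw [hc_def]
    ring
  simp only [hrad]
  rw [← hsub, ← intervalIntegral.integral_const_mul]
  refine intervalIntegral.integral_congr fun θ hθ => ?_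
  obtain ⟨h₁, h₂⟩ := hneg θ hθ
  simp only [Function.comp_apply]
  rw [mul_add_sqrt_eq_of_mem hr0.ne' hc.le h₁ h₂, hc_def]
  ring
end

section
/- Let 0 < R0 < r' < r and κ_t ∈ ℝ, and set μ_d(r) = −√(1 − R0²/r²). Then ∫_{−1}^{μ_d(r)} exp(κ_t(rμ + √(r²μ² − r² + r'²))) / √(r²μ² − r² + r'²) dμ = (1/r) ∫_{r'−r}^{√(r'²−R0²) − √(r²−R0²)} e^{κ_t ν}/ν dν, where the right-hand side is an oriented interval integral. -/
open Real Set MeasureTheory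

/-- The map `μ ↦ rμ + √(r²μ² - r² + s²)` solves the differential equation `ν' = rν/√(…)`. -/
theorem hasDerivAt_mul_add_sqrt {r s μ : ℝ} (h : 0 < r^2 * μ^2 - r^2 + s^2) :
    HasDerivAt (fun μ : ℝ => r * μ + √(r^2 * μ^2 - r^2 + s^2))
      (r * (r * μ + √(r^2 * μ^2 - r^2 + s^2)) / √(r^2 * μ^2 - r^2 + s^2)) μ := by
  have hs : √(r^2 * μ^2 - r^2 + s^2) ≠ 0 := (Real.sqrt_pos.2 h).ne'
  have hq : HasDerivAt (fun μ : ℝ => r^2 * μ^2 - r^2 + s^2) (r^2 * (2 * μ)) μ := by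
    simpa using (((hasDerivAt_pow 2 μ).const_mul (r^2)).sub_const (r^2)).add_const (s^2)
  refine (((hasDerivAt_id μ).const_mul r).add (hq.sqrt h.ne')).congr_deriv ?_
  generalize √(r^2 * μ^2 - r^2 + s^2) = q at hs ⊢
  field_simp
  ring

/-- Substitution `ν = rμ + √(r²μ² − r² + r'²)` in the inner `μ`-integral of the
term `I_1` of the integral equation for the importance function. -/
theorem I1_substitution
    (R0 r' r κt : ℝ) (hR0 : 0 < R0) (hr' : R0 < r') (hr : r' < r) :
    ∫ μ in (-1:ℝ)..(-Real.sqrt (1 - R0^2 / r^2)),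
        Real.exp (κt * (r * μ + Real.sqrt (r^2 * μ^2 - r^2 + r'^2)))
          / Real.sqrt (r^2 * μ^2 - r^2 + r'^2)
      = (1 / r) * ∫ ν in (r' - r)..(Real.sqrt (r'^2 - R0^2) - Real.sqrt (r^2 - R0^2)),
          Real.exp (κt * ν) / ν := by
  have hr'0 : 0 < r' := hR0.trans hr'
  have hr0 : 0 < r := hr'0.trans hr
  have hR0r : 0 < r^2 - R0^2 := by nlinarith
  have hscale : r^2 * (1 - R0^2 / r^2) = r^2 - R0^2 := by field_simp
  have hpos : 0 < 1 - R0^2 / r^2 := by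
    by_contra! h
    nlinarith [sq_nonneg r]
  have hm0 : 0 < √(1 - R0^2 / r^2) := Real.sqrt_pos.2 hpos
  have hmsq : √(1 - R0^2 / r^2)^2 = 1 - R0^2 / r^2 := Real.sq_sqrt hpos.le
  have hrm : r * √(1 - R0^2 / r^2) = √(r^2 - R0^2) := by
    rw [← hscale, Real.sqrt_mul (sq_nonneg r), Real.sqrt_sq hr0.le]
  have hm1 : √(1 - R0^2 / r^2) ≤ 1 := by
    rw [Real.sqrt_le_iff]
    refine ⟨zero_le_one, ?_⟩
    have : 0 ≤ R0^2 / r^2 := by positivity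
    linarith
  generalize √(1 - R0^2 / r^2) = m at *
  set f : ℝ → ℝ := fun μ => r * μ + √(r^2 * μ^2 - r^2 + r'^2) with hf
  have huIcc : uIcc (-1) (-m) = Icc (-1) (-m) := uIcc_of_le (by linarith)
  have hQ : ∀ μ ∈ uIcc (-1) (-m), 0 < r^2 * μ^2 - r^2 + r'^2 := by
    intro μ hμ
    rw [huIcc] at hμ
    have h1 : m^2 ≤ μ^2 := by nlinarith [hμ.2]
    have h2 : r^2 * m^2 ≤ r^2 * μ^2 := by gcongr
    rw [hmsq, hscale] at h2
    nlinarith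
  have hneg : ∀ μ ∈ uIcc (-1) (-m), f μ < 0 := by
    intro μ hμ
    rw [huIcc] at hμ
    have h : √(r^2 * μ^2 - r^2 + r'^2) < -(r * μ) := by
      rw [Real.sqrt_lt' (by nlinarith [hμ.2])]
      nlinarith
    simp only [hf]
    linarith
  have hfc : Continuous f := by fun_prop
  have hsub := intervalIntegral.integral_comp_mul_deriv' (a := -1) (b := -m) (f := f)
    (f' := fun μ => r * f μ / √(r^2 * μ^2 - r^2 + r'^2)) (g := fun ν => Real.exp (κt * ν) / ν)
    (fun μ hμ => hasDerivAt_mul_add_sqrt (hQ μ hμ))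
    (ContinuousOn.div (by fun_prop) (by fun_prop) fun μ hμ => (Real.sqrt_pos.2 (hQ μ hμ)).ne')
    (ContinuousOn.div (by fun_prop) (by fun_prop) <| by
      rintro _ ⟨μ, hμ, rfl⟩
      exact (hneg μ hμ).ne)
  have hleft : f (-1) = r' - r := by
    have : r^2 * (-1)^2 - r^2 + r'^2 = r'^2 := by ring
    simp only [hf]
    rw [this, Real.sqrt_sq hr'0.le]
    ring
  have hright : f (-m) = √(r'^2 - R0^2) - √(r^2 - R0^2) := by
    have : r^2 * (-m)^2 - r^2 + r'^2 = r'^2 - R0^2 := by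
      rw [neg_sq, hmsq, hscale]
      ring
    simp only [hf]
    rw [this, ← hrm]
    ring
  rw [← hleft, ← hright, ← hsub, ← intervalIntegral.integral_const_mul]
  refine intervalIntegral.integral_congr fun μ hμ => ?_
  have hfμ : f μ ≠ 0 := (hneg μ hμ).ne
  have hs : √(r^2 * μ^2 - r^2 + r'^2) ≠ 0 := (Real.sqrt_pos.2 (hQ μ hμ)).ne'
  change Real.exp (κt * f μ) / _ = 1 / r * (Real.exp (κt * f μ) / f μ * (r * f μ / _))
  field_simp
end

section
/- Let 0 < R0 < r ≤ r' and κ_t ∈ ℝ, and set μ_d(r) = −√(1 − R0²/r²). Then ∫_{μ_d(r)}^{0} exp(κ_t(rμ − √(r²μ² − r² + r'²))) / √(r²μ² − r² + r'²) dμ = (1/r) ∫_{−√(r'²−r²)}^{−√(r²−R0²) − √(r'²−R0²)} e^{κ_t ν}/ν dν, where the right-hand side is an oriented interval integral. -/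
open Real Set MeasureTheory

/-- Substitution `ν = rμ − √(r²μ² − r² + r'²)` in the inner `μ`-integral of the
term `I_3` of the integral equation for the importance function (case `r ≤ r'`). -/
theorem I3_substitution
    (R0 r r' κt : ℝ) (hR0 : 0 < R0) (hr : R0 < r) (hrr' : r ≤ r') :
    ∫ μ in (-Real.sqrt (1 - R0^2 / r^2))..(0:ℝ),
        Real.exp (κt * (r * μ - Real.sqrt (r^2 * μ^2 - r^2 + r'^2)))
          / Real.sqrt (r^2 * μ^2 - r^2 + r'^2)
      = (1 / r) * ∫ ν in (-Real.sqrt (r'^2 - r^2))..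
            (-Real.sqrt (r^2 - R0^2) - Real.sqrt (r'^2 - R0^2)),
          Real.exp (κt * ν) / ν := by
  have hr0 : 0 < r := hR0.trans hr
  have hsq : 0 ≤ 1 - R0 ^ 2 / r ^ 2 := by
    rw [sub_nonneg, div_le_one (by positivity)]
    exact pow_le_pow_left₀ hR0.le hr.le 2
  have hscale : r * √(1 - R0 ^ 2 / r ^ 2) = √(r ^ 2 - R0 ^ 2) := by
    rw [← sqrt_sq hr0.le, ← sqrt_mul (sq_nonneg _), sqrt_sq hr0.le]
    congr 1
    field_simp
  have hm0 : -√(1 - R0 ^ 2 / r ^ 2) ≤ 0 := neg_nonpos.mpr (sqrt_nonneg _)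
  rcases hrr'.eq_or_lt with rfl | hlt
  · -- Both integrands are singular here, but the substitution is linear.
    have hcongr : ∀ μ ∈ uIcc (-√(1 - R0 ^ 2 / r ^ 2)) 0,
        exp (κt * (r * μ - √(r ^ 2 * μ ^ 2 - r ^ 2 + r ^ 2))) / √(r ^ 2 * μ ^ 2 - r ^ 2 + r ^ 2)
          = (fun ν ↦ -2 * (exp (κt * ν) / ν)) (2 * r * μ) := by
      intro μ hμ
      rw [uIcc_of_le hm0] at hμ
      have hs : √(r ^ 2 * μ ^ 2 - r ^ 2 + r ^ 2) = -(r * μ) := by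
        rw [show r ^ 2 * μ ^ 2 - r ^ 2 + r ^ 2 = (-(r * μ)) ^ 2 by ring]
        exact sqrt_sq (neg_nonneg.mpr (mul_nonpos_of_nonneg_of_nonpos hr0.le hμ.2))
      simp only [hs]
      rw [show r * μ - -(r * μ) = 2 * r * μ by ring]
      rcases eq_or_ne μ 0 with rfl | h0
      · simp
      · field_simp
    rw [intervalIntegral.integral_congr hcongr,
      intervalIntegral.integral_comp_mul_left (fun ν ↦ -2 * (exp (κt * ν) / ν)) (by positivity : 2 * r ≠ 0),
      intervalIntegral.integral_const_mul, intervalIntegral.integral_symm (2 * r * 0),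
      show 2 * r * -√(1 - R0 ^ 2 / r ^ 2) = -√(r ^ 2 - R0 ^ 2) - √(r ^ 2 - R0 ^ 2) by
        rw [← hscale]; ring]
    simp only [mul_zero, sub_self, sqrt_zero, neg_zero, smul_eq_mul]
    field_simp
  · have hpos : ∀ μ : ℝ, 0 < r ^ 2 * μ ^ 2 - r ^ 2 + r' ^ 2 := fun μ ↦ by
      have := pow_lt_pow_left₀ hlt hr0.le two_ne_zero
      nlinarith [sq_nonneg (r * μ)]
    have hneg : ∀ μ : ℝ, r * μ - √(r ^ 2 * μ ^ 2 - r ^ 2 + r' ^ 2) < 0 := fun μ ↦ by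
      have := pow_lt_pow_left₀ hlt hr0.le two_ne_zero
      exact sub_neg.mpr (lt_sqrt_of_sq_lt (by nlinarith))
    have hderiv : ∀ μ : ℝ, HasDerivAt (fun μ ↦ r * μ - √(r ^ 2 * μ ^ 2 - r ^ 2 + r' ^ 2))
        (r - r ^ 2 * (2 * μ) / (2 * √(r ^ 2 * μ ^ 2 - r ^ 2 + r' ^ 2))) μ := fun μ ↦ by
      have h1 : HasDerivAt (fun μ : ℝ ↦ r ^ 2 * μ ^ 2 - r ^ 2 + r' ^ 2) (r ^ 2 * (2 * μ)) μ := by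
        simpa using (((hasDerivAt_pow 2 μ).const_mul (r ^ 2)).sub_const (r ^ 2)).add_const (r' ^ 2)
      simpa using ((hasDerivAt_id' μ).const_mul r).fun_sub (h1.sqrt (hpos μ).ne')
    have key := intervalIntegral.integral_comp_mul_deriv'
      (a := -√(1 - R0 ^ 2 / r ^ 2)) (b := 0) (g := fun ν ↦ exp (κt * ν) / ν)
      (fun μ _ ↦ hderiv μ)
      (by
        have hne : ∀ μ : ℝ, 2 * √(r ^ 2 * μ ^ 2 - r ^ 2 + r' ^ 2) ≠ 0 := fun μ ↦
          mul_ne_zero two_ne_zero (sqrt_pos.mpr (hpos μ)).ne'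
        exact (Continuous.sub (by fun_prop)
          (Continuous.div (by fun_prop) (by fun_prop) hne)).continuousOn)
      (by
        refine ContinuousOn.div (by fun_prop) (by fun_prop) ?_
        rintro _ ⟨μ, -, rfl⟩
        exact (hneg μ).ne)
    have hlower : r * -√(1 - R0 ^ 2 / r ^ 2)
          - √(r ^ 2 * (-√(1 - R0 ^ 2 / r ^ 2)) ^ 2 - r ^ 2 + r' ^ 2)
        = -√(r ^ 2 - R0 ^ 2) - √(r' ^ 2 - R0 ^ 2) := by
      rw [neg_sq, sq_sqrt hsq, mul_neg, hscale]
      congr 2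
      field_simp
      ring
    have hupper : r * 0 - √(r ^ 2 * 0 ^ 2 - r ^ 2 + r' ^ 2) = -√(r' ^ 2 - r ^ 2) := by
      rw [mul_zero, zero_sub]
      congr 2
      ring
    rw [hlower, hupper] at key
    rw [intervalIntegral.integral_symm _ (-√(r' ^ 2 - r ^ 2)), ← key, ← intervalIntegral.integral_neg,
      ← intervalIntegral.integral_const_mul]
    refine intervalIntegral.integral_congr fun μ _ ↦ ?_
    have hs := (sqrt_pos.mpr (hpos μ)).ne'
    have hν := (hneg μ).ne
    simp only [Function.comp_apply]
    generalize √(r ^ 2 * μ ^ 2 - r ^ 2 + r' ^ 2) = s at hs hν ⊢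
    field_simp
    ring
end

section
/- Let 0 < R0 < r < r' and κ_t ∈ ℝ. Then ∫_{0}^{1} exp(κ_t(rμ − √(r²μ² − r² + r'²))) / √(r²μ² − r² + r'²) dμ = (1/r) ∫_{r−r'}^{−√(r'²−r²)} e^{κ_t ν}/ν dν, where the right-hand side is an oriented interval integral. -/
open Real Set MeasureTheory

/-- Substitution `ν = rμ − √(r²μ² − r² + r'²)` in the inner `μ`-integral of the
term `I_4` of the integral equation for the importance function. -/
theorem I4_substitution
    (R0 r r' κt : ℝ) (hR0 : 0 < R0) (hr : R0 < r) (hrr' : r < r') :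
    ∫ μ in (0:ℝ)..1,
        Real.exp (κt * (r * μ - Real.sqrt (r^2 * μ^2 - r^2 + r'^2)))
          / Real.sqrt (r^2 * μ^2 - r^2 + r'^2)
      = (1 / r) * ∫ ν in (r - r')..(-Real.sqrt (r'^2 - r^2)),
          Real.exp (κt * ν) / ν := by
  have hr0 : 0 < r := hR0.trans hr
  have hgap : 0 < r' ^ 2 - r ^ 2 := by nlinarith
  have hrad : ∀ μ : ℝ, 0 < r ^ 2 * μ ^ 2 - r ^ 2 + r' ^ 2 := fun μ => by
    nlinarith [sq_nonneg (r * μ)]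
  have hsqrt : ∀ μ : ℝ, 0 < √(r ^ 2 * μ ^ 2 - r ^ 2 + r' ^ 2) := fun μ =>
    Real.sqrt_pos.mpr (hrad μ)
  have hneg : ∀ μ : ℝ, r * μ - √(r ^ 2 * μ ^ 2 - r ^ 2 + r' ^ 2) < 0 := fun μ =>
    sub_neg.mpr (Real.lt_sqrt_of_sq_lt (by nlinarith))
  have hderiv : ∀ μ : ℝ, HasDerivAt (fun μ => r * μ - √(r ^ 2 * μ ^ 2 - r ^ 2 + r' ^ 2))
      (r - r ^ 2 * μ / √(r ^ 2 * μ ^ 2 - r ^ 2 + r' ^ 2)) μ := fun μ => by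
    have hpoly : HasDerivAt (fun μ => r ^ 2 * μ ^ 2 - r ^ 2 + r' ^ 2) (r ^ 2 * (2 * μ)) μ := by
      simpa using (((hasDerivAt_pow 2 μ).const_mul (r ^ 2)).sub_const (r ^ 2)).add_const (r' ^ 2)
    refine (((hasDerivAt_id' μ).const_mul r).sub (hpoly.sqrt (hrad μ).ne')).congr_deriv ?_
    have := (hsqrt μ).ne'
    field_simp
  have hsubst := intervalIntegral.integral_comp_mul_deriv' (a := 0) (b := 1)
    (g := fun ν => Real.exp (κt * ν) / ν) (fun μ _ => hderiv μ)
    (Continuous.continuousOn (by fun_prop (disch := exact fun μ => (hsqrt μ).ne')))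
    (ContinuousOn.div (by fun_prop) continuousOn_id (by
      rintro _ ⟨μ, _, rfl⟩
      exact (hneg μ).ne))
  have hzero : r * 0 - √(r ^ 2 * 0 ^ 2 - r ^ 2 + r' ^ 2) = -√(r' ^ 2 - r ^ 2) := by
    ring_nf
  have hone : r * 1 - √(r ^ 2 * 1 ^ 2 - r ^ 2 + r' ^ 2) = r - r' := by
    rw [show r ^ 2 * 1 ^ 2 - r ^ 2 + r' ^ 2 = r' ^ 2 by ring,
      Real.sqrt_sq (hr0.trans hrr').le, mul_one]
  rw [hzero, hone] at hsubst
  rw [intervalIntegral.integral_symm (-√(r' ^ 2 - r ^ 2)) (r - r'), ← hsubst, ← intervalIntegral.integral_neg,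
    ← intervalIntegral.integral_const_mul]
  refine intervalIntegral.integral_congr fun μ _ => ?_
  have hν := (hneg μ).ne
  have hs := (hsqrt μ).ne'
  simp only [Function.comp_apply]
  generalize √(r ^ 2 * μ ^ 2 - r ^ 2 + r' ^ 2) = s at hν hs ⊢
  field_simp
  ring
end

section
/- Let 0 < R0 < R1, κ_t ∈ ℝ, κ_s ∈ ℝ, and let φ : [R0,R1] → ℝ be continuous. Set S(r) = φ(r)/r, μ_d(r) = −√(1 − R0²/r²), and define for (r,μ) ∈ (R0,R1) × [−1,1]: I(r,μ) = 𝟙{μ < μ_d(r)} · exp(κ_t(rμ + √(R0² − r² + r²μ²))) + ∫_{rμ}^{R(r,μ)} S(√(s² + r² − r²μ²)) exp(κ_t(rμ − s)) ds, where R(r,μ) = −√(R0² − r² + r²μ²) if μ < μ_d(r) and R(r,μ) = √(R1² − r² + r²μ²) otherwise. Then for every r ∈ (R0,R1): (κ_s r/2) ∫_{−1}^{1} I(r,μ) dμ = (κ_s/4) ∫_{R0−r}^{−√(r²−R0²)} e^{κ_t θ}(1 + (R0² − r²)/θ²) dθ + (κ_s/2) ∫_{R0}^{R1} φ(r') ( ∫_{−|r−r'|}^{−√(r²−R0²)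 − √(r'²−R0²)} e^{κ_t ν}/ν dν ) dr'. -/
open Real Set MeasureTheory

/-- The critical direction cosine `μ_d(r) = −√(1 − R0²/r²)`. -/
noncomputable def mud (R0 r : ℝ) : ℝ := -Real.sqrt (1 - R0^2 / r^2)

/-- The endpoint `R(r,μ)` of the characteristic through `(r,μ)`. -/
noncomputable def Rend (R0 R1 r μ : ℝ) : ℝ :=
  if μ < mud R0 r then -Real.sqrt (R0^2 - r^2 + r^2 * μ^2)
  else Real.sqrt (R1^2 - r^2 + r^2 * μ^2)

/-- The characteristic-formula importance function `I(r,μ)` built from the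
source `S(r) = φ(r)/r`. -/
noncomputable def impFun (R0 R1 κt : ℝ) (φ : ℝ → ℝ) (r μ : ℝ) : ℝ :=
  (if μ < mud R0 r
    then Real.exp (κt * (r * μ + Real.sqrt (R0^2 - r^2 + r^2 * μ^2)))
    else 0)
  + ∫ s in (r * μ)..(Rend R0 R1 r μ),
      (φ (Real.sqrt (s^2 + r^2 - r^2 * μ^2)) / Real.sqrt (s^2 + r^2 - r^2 * μ^2))
        * Real.exp (κt * (r * μ - s))

/-- The source kernel in the variables `t` (travelled length) and `x` (radius), cut off to the
part of the annulus visible from radius `r`. -/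
noncomputable def visibleSource (R0 R1 κt : ℝ) (φ : ℝ → ℝ) (r t x : ℝ) : ℝ :=
  if R0 < x ∧ x < R1 ∧ t < √(r ^ 2 - R0 ^ 2) + √(x ^ 2 - R0 ^ 2)
  then φ x * exp (-κt * t) else 0

/-- The density in the variables `t` and `x` after integrating over the direction: a chord of
length `t` joins the radii `r` and `x` only if `|r - t| < x < r + t`. -/
noncomputable def chordKernel (R0 R1 κt : ℝ) (φ : ℝ → ℝ) (r t x : ℝ) : ℝ :=
  if |r - t| < x ∧ x < r + t then visibleSource R0 R1 κt φ r t x / (r * t) else 0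

lemma mul_mud {R0 r : ℝ} (hR0 : 0 < R0) (hr : R0 < r) :
    r * mud R0 r = -√(r ^ 2 - R0 ^ 2) := by
  have hr0 : 0 < r := hR0.trans hr
  have h : r ^ 2 - R0 ^ 2 = r ^ 2 * (1 - R0 ^ 2 / r ^ 2) := by field_simp
  rw [mud, h, sqrt_mul (sq_nonneg r), sqrt_sq hr0.le]
  ring

lemma lt_mud_iff {R0 r μ : ℝ} (hR0 : 0 < R0) (hr : R0 < r) :
    μ < mud R0 r ↔ r * μ < -√(r ^ 2 - R0 ^ 2) := by
  rw [← mul_mud hR0 hr, mul_lt_mul_iff_right₀ (hR0.trans hr)]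

/-- Substituting the signed chord length for the direction cosine in the boundary term. -/
lemma integral_boundary_term {R0 r : ℝ} (κt : ℝ) (hR0 : 0 < R0) (hr : R0 < r) :
    r * ∫ μ in (-1 : ℝ)..mud R0 r, exp (κt * (r * μ + √(R0 ^ 2 - r ^ 2 + r ^ 2 * μ ^ 2))) =
      (1 / 2) * ∫ θ in (R0 - r)..(-√(r ^ 2 - R0 ^ 2)),
        exp (κt * θ) * (1 + (R0 ^ 2 - r ^ 2) / θ ^ 2) := by
  have hr0 : 0 < r := hR0.trans hr
  have hq2 : 0 < r ^ 2 - R0 ^ 2 := by nlinarith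
  have hmud := mul_mud hR0 hr
  set q := √(r ^ 2 - R0 ^ 2) with hq
  have hq0 : 0 < q := sqrt_pos.2 hq2
  have hqq : q ^ 2 = r ^ 2 - R0 ^ 2 := sq_sqrt hq2.le
  have hle : -q ≤ R0 - r := by nlinarith
  have hmem : ∀ θ ∈ uIcc (R0 - r) (-q), -q ≤ θ ∧ θ < 0 := by
    intro θ hθ
    rw [uIcc_of_ge hle] at hθ
    exact ⟨hθ.1, by linarith [hθ.2]⟩
  have key := intervalIntegral.integral_comp_mul_deriv
    (a := R0 - r) (b := -q) (f := fun θ => (θ + q ^ 2 / θ) / (2 * r))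
    (f' := fun θ => (1 + q ^ 2 * (-(θ ^ 2)⁻¹)) / (2 * r))
    (g := fun μ => exp (κt * (r * μ + √(R0 ^ 2 - r ^ 2 + r ^ 2 * μ ^ 2))))
    (fun θ hθ => by
      have := (hmem θ hθ).2.ne
      exact ((hasDerivAt_id θ).add ((hasDerivAt_inv this).const_mul (q ^ 2))).div_const (2 * r))
    (by
      refine ContinuousOn.div_const (continuousOn_const.add (continuousOn_const.mul
        (ContinuousOn.neg (ContinuousOn.inv₀ (by fun_prop) ?_)))) _
      intro θ hθ
      exact pow_ne_zero 2 (hmem θ hθ).2.ne)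
    (by fun_prop)
  have h1 : (R0 - r + q ^ 2 / (R0 - r)) / (2 * r) = -1 := by
    have : R0 - r ≠ 0 := by linarith
    rw [hqq]; field_simp; ring
  have h2 : (-q + q ^ 2 / (-q)) / (2 * r) = mud R0 r := by
    have : mud R0 r = -q / r := by field_simp; linarith
    rw [this]; field_simp; ring
  simp only [h1, h2] at key
  rw [← key, ← intervalIntegral.integral_const_mul, ← intervalIntegral.integral_const_mul]
  refine intervalIntegral.integral_congr fun θ hθ => ?_
  obtain ⟨hθ1, hθ0⟩ := hmem θ hθ
  have hθn := hθ0.ne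
  have hm : r * ((θ + q ^ 2 / θ) / (2 * r)) = (θ + q ^ 2 / θ) / 2 := by field_simp
  have hnn : 0 ≤ (θ - q ^ 2 / θ) / 2 := by
    have : (θ - q ^ 2 / θ) / 2 = (q ^ 2 - θ ^ 2) / (2 * -θ) := by field_simp; ring
    rw [this]
    exact div_nonneg (by nlinarith) (by linarith)
  have hs : √(R0 ^ 2 - r ^ 2 + r ^ 2 * ((θ + q ^ 2 / θ) / (2 * r)) ^ 2) =
      (θ - q ^ 2 / θ) / 2 := by
    rw [← mul_pow, hm, ← neg_sub (r ^ 2), ← hqq, ← sqrt_sq hnn]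
    congr 1
    field_simp
    ring
  simp only [Function.comp_apply, hs, hm]
  rw [← neg_sub (r ^ 2), ← hqq]
  have : (θ + q ^ 2 / θ) / 2 + (θ - q ^ 2 / θ) / 2 = θ := by ring
  rw [this]
  field_simp

/-- The point at distance `t` along the characteristic lies before the endpoint exactly when its
radius is in the annulus and it is visible from radius `r`. -/
lemma add_lt_Rend_iff {R0 R1 r μ t : ℝ} (hR0 : 0 < R0) (hr : R0 < r) (hr1 : r < R1)
    (hμ : μ ∈ Ioo (-1 : ℝ) 1) (hμd : μ ≠ mud R0 r) (ht : 0 < t) :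
    t < Rend R0 R1 r μ - r * μ ↔
      R0 < √(t ^ 2 + 2 * (r * μ) * t + r ^ 2) ∧ √(t ^ 2 + 2 * (r * μ) * t + r ^ 2) < R1 ∧
        t < √(r ^ 2 - R0 ^ 2) + √(√(t ^ 2 + 2 * (r * μ) * t + r ^ 2) ^ 2 - R0 ^ 2) := by
  have hr0 : 0 < r := hR0.trans hr
  have hm1 : -r < r * μ := by nlinarith [hμ.1]
  have hm2 : r * μ < r := by nlinarith [hμ.2]
  have hiff := lt_mud_iff (μ := μ) hR0 hr
  have hne : r * μ ≠ -√(r ^ 2 - R0 ^ 2) := by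
    rw [← mul_mud hR0 hr]
    exact fun h => hμd (mul_left_cancel₀ hr0.ne' h)
  unfold Rend
  rw [← mul_pow]
  simp only [hiff]
  generalize r * μ = m at *
  have hX : 0 < t ^ 2 + 2 * m * t + r ^ 2 := by nlinarith [sq_nonneg (t + m)]
  have hq2 : 0 < r ^ 2 - R0 ^ 2 := by nlinarith
  rw [sq_sqrt hX.le, lt_sqrt hR0.le, sqrt_lt' (by linarith)]
  have hqq : √(r ^ 2 - R0 ^ 2) ^ 2 = r ^ 2 - R0 ^ 2 := sq_sqrt hq2.le
  have hq0 : 0 < √(r ^ 2 - R0 ^ 2) := sqrt_pos.2 hq2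
  generalize √(r ^ 2 - R0 ^ 2) = q at *
  split_ifs with hc
  · have hw2 : 0 < R0 ^ 2 - r ^ 2 + m ^ 2 := by nlinarith
    have hww := sq_sqrt hw2.le
    have hw0 := sqrt_pos.2 hw2
    generalize √(R0 ^ 2 - r ^ 2 + m ^ 2) = w at *
    constructor
    · intro h
      have hXR : R0 ^ 2 < t ^ 2 + 2 * m * t + r ^ 2 := by nlinarith
      have hy0 := sqrt_pos.2 (sub_pos.2 hXR)
      refine ⟨hXR, by nlinarith, ?_⟩
      have : t < q := by
        by_contra! hcon
        nlinarith
      linarith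
    · rintro ⟨h1, -, h3⟩
      have hyy := sq_sqrt (sub_pos.2 h1).le
      have hy0 := sqrt_pos.2 (sub_pos.2 h1)
      generalize √(t ^ 2 + 2 * m * t + r ^ 2 - R0 ^ 2) = y at *
      have htq : t < q := by
        by_contra! hcon
        nlinarith
      by_contra! hcon
      have : w < -(t + m) := lt_of_pow_lt_pow_left₀ 2 (by linarith) (by nlinarith)
      linarith
  · have hc' : -q < m := lt_of_le_of_ne (not_lt.1 hc) (Ne.symm hne)
    have hw2 : 0 < R1 ^ 2 - r ^ 2 + m ^ 2 := by nlinarith [sq_nonneg m]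
    have hww := sq_sqrt hw2.le
    have hw0 := sqrt_pos.2 hw2
    generalize √(R1 ^ 2 - r ^ 2 + m ^ 2) = w at *
    have hmw : |m| < w := abs_lt_of_sq_lt_sq (by nlinarith) hw0.le
    rw [abs_lt] at hmw
    constructor
    · intro h
      have hXR : R0 ^ 2 < t ^ 2 + 2 * m * t + r ^ 2 := by
        rcases le_or_gt 0 m with h0 | h0 <;> nlinarith [sq_nonneg (t + m), mul_pos ht ht]
      have hyy := sq_sqrt (sub_pos.2 hXR).le
      have hy0 := sqrt_pos.2 (sub_pos.2 hXR)
      refine ⟨hXR, by nlinarith, ?_⟩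
      generalize √(t ^ 2 + 2 * m * t + r ^ 2 - R0 ^ 2) = y at *
      by_contra! hcon
      nlinarith
    · rintro ⟨-, h2, -⟩
      have := abs_lt.1 (abs_lt_of_sq_lt_sq (a := t + m) (b := w) (by nlinarith) hw0.le)
      linarith

lemma Rend_sub_mem_Icc {R0 R1 r μ : ℝ} (hR0 : 0 < R0) (hr : R0 < r) (hr1 : r < R1)
    (hμ : μ ∈ Ioo (-1 : ℝ) 1) : Rend R0 R1 r μ - r * μ ∈ Icc 0 (R1 + r) := by
  have hr0 : 0 < r := hR0.trans hr
  have hm1 : -r < r * μ := by nlinarith [hμ.1]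
  have hm2 : r * μ < r := by nlinarith [hμ.2]
  have hiff := lt_mud_iff (μ := μ) hR0 hr
  unfold Rend
  rw [← mul_pow]
  simp only [hiff]
  generalize r * μ = m at *
  have hq0 := sqrt_nonneg (r ^ 2 - R0 ^ 2)
  have h0 := sqrt_nonneg (R0 ^ 2 - r ^ 2 + m ^ 2)
  split_ifs with hc
  · have : √(R0 ^ 2 - r ^ 2 + m ^ 2) ≤ -m := sqrt_le_iff.2 ⟨by linarith, by nlinarith⟩
    constructor <;> linarith
  · have h1 : √(R1 ^ 2 - r ^ 2 + m ^ 2) ≤ R1 := sqrt_le_iff.2 ⟨by linarith, by nlinarith⟩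
    have h2 : m ≤ √(R1 ^ 2 - r ^ 2 + m ^ 2) := le_sqrt_of_sq_le (by nlinarith)
    constructor <;> linarith

/-- The source part of the importance function in terms of `visibleSource`. -/
lemma integral_characteristic {R0 R1 r μ : ℝ} (κt : ℝ) (φ : ℝ → ℝ) (hR0 : 0 < R0) (hr : R0 < r)
    (hr1 : r < R1) (hμ : μ ∈ Ioo (-1 : ℝ) 1) (hμd : μ ≠ mud R0 r) :
    (∫ s in (r * μ)..(Rend R0 R1 r μ),
      (φ (√(s ^ 2 + r ^ 2 - r ^ 2 * μ ^ 2)) / √(s ^ 2 + r ^ 2 - r ^ 2 * μ ^ 2))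
        * exp (κt * (r * μ - s))) =
    ∫ t in Ioo 0 (R1 + r),
      visibleSource R0 R1 κt φ r t (√(t ^ 2 + 2 * (r * μ) * t + r ^ 2)) /
        √(t ^ 2 + 2 * (r * μ) * t + r ^ 2) := by
  obtain ⟨hL0, hLT⟩ := Rend_sub_mem_Icc hR0 hr hr1 hμ
  have hshift := intervalIntegral.integral_comp_add_right (a := 0) (b := Rend R0 R1 r μ - r * μ)
    (fun s => (φ (√(s ^ 2 + r ^ 2 - r ^ 2 * μ ^ 2)) / √(s ^ 2 + r ^ 2 - r ^ 2 * μ ^ 2))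
        * exp (κt * (r * μ - s))) (r * μ)
  rw [zero_add, sub_add_cancel] at hshift
  rw [← hshift, intervalIntegral.integral_of_le hL0, integral_Ioc_eq_integral_Ioo]
  have hset : Ioo 0 (Rend R0 R1 r μ - r * μ) = Ioo 0 (R1 + r) ∩ Iio (Rend R0 R1 r μ - r * μ) := by
    rw [Ioo_inter_Iio, min_eq_right hLT]
  rw [hset, ← setIntegral_indicator measurableSet_Iio]
  refine setIntegral_congr_fun measurableSet_Ioo fun t ht => ?_
  have hiff := add_lt_Rend_iff hR0 hr hr1 hμ hμd ht.1
  have hX : (t + r * μ) ^ 2 + r ^ 2 - r ^ 2 * μ ^ 2 = t ^ 2 + 2 * (r * μ) * t + r ^ 2 := by ring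
  have hE : κt * (r * μ - (t + r * μ)) = -κt * t := by ring
  simp only [indicator_apply, mem_Iio, visibleSource, hiff, hX, hE]
  split_ifs <;> ring

lemma measurable_visibleSource {R0 R1 : ℝ} (κt r : ℝ) {φ : ℝ → ℝ}
    (hφ : ContinuousOn φ (Icc R0 R1)) :
    Measurable fun p : ℝ × ℝ => visibleSource R0 R1 κt φ r p.1 p.2 := by
  classical
  have hφm : Measurable ((Icc R0 R1).indicator φ) := by
    have := hφ.measurable_piecewise (g := fun _ => (0 : ℝ)) continuousOn_const measurableSet_Icc
    convert this using 1
    exact (piecewise_eq_indicator (f := φ)).symm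
  have heq : (fun p : ℝ × ℝ => visibleSource R0 R1 κt φ r p.1 p.2) = fun p =>
      if R0 < p.2 ∧ p.2 < R1 ∧ p.1 < √(r ^ 2 - R0 ^ 2) + √(p.2 ^ 2 - R0 ^ 2)
      then (Icc R0 R1).indicator φ p.2 * exp (-κt * p.1) else 0 := by
    ext p
    unfold visibleSource
    split_ifs with h
    · rw [indicator_of_mem (show p.2 ∈ Icc R0 R1 from ⟨h.1.le, h.2.1.le⟩)]
    · rfl
  rw [heq]
  have hS : MeasurableSet {p : ℝ × ℝ |
      R0 < p.2 ∧ p.2 < R1 ∧ p.1 < √(r ^ 2 - R0 ^ 2) + √(p.2 ^ 2 - R0 ^ 2)} :=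
    (measurableSet_lt measurable_const measurable_snd).inter
      ((measurableSet_lt measurable_snd measurable_const).inter
        (measurableSet_lt measurable_fst (by fun_prop)))
  exact Measurable.ite hS ((hφm.comp measurable_snd).mul (by fun_prop)) measurable_const

lemma exists_abs_visibleSource_le {R0 R1 : ℝ} (κt r T : ℝ) {φ : ℝ → ℝ}
    (hφ : ContinuousOn φ (Icc R0 R1)) :
    ∃ C, 0 ≤ C ∧ ∀ t ∈ Ioo 0 T, ∀ x, |visibleSource R0 R1 κt φ r t x| ≤ C := by
  obtain ⟨M, hM⟩ := isCompact_Icc.exists_bound_of_continuousOn hφ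
  refine ⟨|M| * exp (|κt| * T), by positivity, fun t ht x => ?_⟩
  unfold visibleSource
  split_ifs with h
  · rw [abs_mul, abs_exp]
    refine mul_le_mul ((hM x ⟨h.1.le, h.2.1.le⟩).trans (le_abs_self M)) (exp_le_exp.2 ?_)
      (exp_nonneg _) (abs_nonneg M)
    exact mul_le_mul (neg_le_abs κt) ht.2.le ht.1.le (abs_nonneg κt)
  · rw [abs_zero]; positivity

/-- For fixed length `t`, substituting the radius for the direction cosine. -/
lemma integral_direction_eq_integral_radius {r t : ℝ} (g : ℝ → ℝ) (hr : 0 < r) (ht : 0 < t) :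
    ∫ μ in Ioo (-1 : ℝ) 1,
      g (√(t ^ 2 + 2 * (r * μ) * t + r ^ 2)) / √(t ^ 2 + 2 * (r * μ) * t + r ^ 2) =
    ∫ x in Ioo |r - t| (r + t), g x / (r * t) := by
  have himg : (fun x => (x ^ 2 - r ^ 2 - t ^ 2) / (2 * r * t)) '' Ioo |r - t| (r + t) =
      Ioo (-1 : ℝ) 1 := by
    ext μ
    constructor
    · rintro ⟨x, ⟨hx1, hx2⟩, rfl⟩
      have hx0 : 0 < x := (abs_nonneg _).trans_lt hx1
      have h1 : (r - t) ^ 2 < x ^ 2 := by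
        rw [← sq_abs (r - t)]
        exact pow_lt_pow_left₀ hx1 (abs_nonneg _) two_ne_zero
      have h2 : 0 < 2 * r * t := by positivity
      constructor
      · rw [lt_div_iff₀ h2]; nlinarith
      · rw [div_lt_iff₀ h2]; nlinarith
    · rintro ⟨h1, h2⟩
      have hrt : 0 < r * t := by positivity
      have hX : 0 ≤ t ^ 2 + 2 * (r * μ) * t + r ^ 2 := by nlinarith [sq_nonneg (r - t)]
      refine ⟨√(t ^ 2 + 2 * (r * μ) * t + r ^ 2), ⟨?_, ?_⟩, ?_⟩
      · rw [lt_sqrt (abs_nonneg _), sq_abs]; nlinarith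
      · rw [sqrt_lt' (by positivity)]; nlinarith
      · simp only [sq_sqrt hX]; field_simp; ring
  have hinj : InjOn (fun x => (x ^ 2 - r ^ 2 - t ^ 2) / (2 * r * t)) (Ioo |r - t| (r + t)) := by
    intro x hx y hy hxy
    have hx0 : 0 < x := (abs_nonneg _).trans_lt hx.1
    have hy0 : 0 < y := (abs_nonneg _).trans_lt hy.1
    have h := (div_left_inj' (by positivity)).1 hxy
    exact (pow_left_inj₀ hx0.le hy0.le two_ne_zero).1 (by linarith)
  rw [← himg, integral_image_eq_integral_abs_deriv_smul (f' := fun x => x / (r * t))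
    measurableSet_Ioo _ hinj]
  · refine setIntegral_congr_fun measurableSet_Ioo fun x hx => ?_
    have hx0 : 0 < x := (abs_nonneg _).trans_lt hx.1
    have hX : t ^ 2 + 2 * (r * ((x ^ 2 - r ^ 2 - t ^ 2) / (2 * r * t))) * t + r ^ 2 = x ^ 2 := by
      field_simp; ring
    simp only [hX, sqrt_sq hx0.le, smul_eq_mul]
    rw [abs_of_pos (by positivity)]
    field_simp
  · intro x hx
    have h := (((hasDerivAt_pow 2 x).sub_const (r ^ 2)).sub_const (t ^ 2)).div_const (2 * r * t)
    refine (h.congr_deriv ?_).hasDerivWithinAt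
    field_simp
    norm_num

lemma integrable_direction_kernel {R0 R1 : ℝ} (κt r T : ℝ) {φ : ℝ → ℝ} (hR0 : 0 < R0)
    (hφ : ContinuousOn φ (Icc R0 R1)) :
    Integrable (fun p : ℝ × ℝ =>
      visibleSource R0 R1 κt φ r p.2 (√(p.2 ^ 2 + 2 * (r * p.1) * p.2 + r ^ 2)) /
        √(p.2 ^ 2 + 2 * (r * p.1) * p.2 + r ^ 2))
      ((volume.restrict (Ioo (-1 : ℝ) 1)).prod (volume.restrict (Ioo 0 T))) := by
  obtain ⟨C, hC0, hC⟩ := exists_abs_visibleSource_le κt r T hφ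
  have hmeas : Measurable fun p : ℝ × ℝ =>
      visibleSource R0 R1 κt φ r p.2 (√(p.2 ^ 2 + 2 * (r * p.1) * p.2 + r ^ 2)) /
        √(p.2 ^ 2 + 2 * (r * p.1) * p.2 + r ^ 2) := by
    have h := (measurable_visibleSource κt r hφ).comp
      (f := fun p : ℝ × ℝ => (p.2, √(p.2 ^ 2 + 2 * (r * p.1) * p.2 + r ^ 2))) (by fun_prop)
    exact h.div (by fun_prop)
  refine Integrable.of_bound hmeas.aestronglyMeasurable (C / R0) ?_
  rw [Measure.prod_restrict]
  filter_upwards [ae_restrict_mem (measurableSet_Ioo.prod measurableSet_Ioo)] with p hp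
  have hb := hC p.2 hp.2 (√(p.2 ^ 2 + 2 * (r * p.1) * p.2 + r ^ 2))
  rw [Real.norm_eq_abs, abs_div, abs_of_nonneg (sqrt_nonneg _)]
  by_cases hx : R0 < √(p.2 ^ 2 + 2 * (r * p.1) * p.2 + r ^ 2)
  · gcongr
  · rw [visibleSource, if_neg (fun h => hx h.1), abs_zero, zero_div]
    positivity

/-- The singularity of `chordKernel` at `t = 0` is integrable because its `x`-section has length
at most `2 t`. -/
lemma integrable_chordKernel {R0 R1 : ℝ} (κt r T : ℝ) {φ : ℝ → ℝ} (hr : 0 < r)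
    (hφ : ContinuousOn φ (Icc R0 R1)) :
    Integrable (fun p : ℝ × ℝ => chordKernel R0 R1 κt φ r p.1 p.2)
      ((volume.restrict (Ioo 0 T)).prod volume) := by
  obtain ⟨C, hC0, hC⟩ := exists_abs_visibleSource_le κt r T hφ
  have hS : MeasurableSet {p : ℝ × ℝ | |r - p.1| < p.2 ∧ p.2 < r + p.1} :=
    (measurableSet_lt (by fun_prop) measurable_snd).inter
      (measurableSet_lt measurable_snd (by fun_prop))
  have hmeas : Measurable fun p : ℝ × ℝ => chordKernel R0 R1 κt φ r p.1 p.2 :=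
    Measurable.ite hS ((measurable_visibleSource κt r hφ).div (by fun_prop)) measurable_const
  have hsec : ∀ t ∈ Ioo 0 T, ∀ x, ‖chordKernel R0 R1 κt φ r t x‖ ≤
      (Ioo (r - t) (r + t)).indicator (fun _ => C / (r * t)) x := by
    intro t ht x
    have hrt : 0 < r * t := mul_pos hr ht.1
    unfold chordKernel
    split_ifs with hx
    · have hx' : x ∈ Ioo (r - t) (r + t) := ⟨(le_abs_self _).trans_lt hx.1, hx.2⟩
      rw [indicator_of_mem hx', Real.norm_eq_abs, abs_div, abs_of_pos hrt]
      gcongr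
      exact hC t ht x
    · rw [norm_zero]
      exact indicator_nonneg (fun _ _ => by positivity) x
  have hint : ∀ t : ℝ, Integrable ((Ioo (r - t) (r + t)).indicator (fun _ => C / (r * t))) :=
    fun t => (integrable_indicator_iff measurableSet_Ioo).2
      (integrableOn_const measure_Ioo_lt_top.ne)
  refine (integrable_prod_iff hmeas.aestronglyMeasurable).2 ⟨?_, ?_⟩
  · filter_upwards [ae_restrict_mem measurableSet_Ioo] with t ht
    exact (hint t).mono'
      (hmeas.comp (by fun_prop : Measurable fun x : ℝ => (t, x))).aestronglyMeasurable
      (Filter.Eventually.of_forall (hsec t ht))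
  · refine Integrable.of_bound hmeas.aestronglyMeasurable.norm.integral_prod_right' (2 * C / r) ?_
    filter_upwards [ae_restrict_mem measurableSet_Ioo] with t ht
    have ht0 := ht.1
    rw [Real.norm_of_nonneg (integral_nonneg fun _ => norm_nonneg _)]
    refine (integral_mono_of_nonneg (Filter.Eventually.of_forall fun _ => norm_nonneg _) (hint t)
      (Filter.Eventually.of_forall (hsec t ht))).trans_eq ?_
    rw [integral_indicator measurableSet_Ioo, setIntegral_const, Real.volume_real_Ioo_of_le
      (by linarith), smul_eq_mul]
    field_simp
    ring

lemma integral_chordKernel_length {R0 R1 r : ℝ} (κt : ℝ) (φ : ℝ → ℝ) (x : ℝ) (hR0 : 0 < R0)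
    (hr : R0 < r) (hr1 : r < R1) :
    ∫ t in Ioo 0 (R1 + r), chordKernel R0 R1 κt φ r t x =
      (Ioo R0 R1).indicator (fun x => r⁻¹ * (φ x * ∫ ν in (-|r - x|)..
        (-√(r ^ 2 - R0 ^ 2) - √(x ^ 2 - R0 ^ 2)), exp (κt * ν) / ν)) x := by
  have hr0 : 0 < r := hR0.trans hr
  by_cases hx : x ∈ Ioo R0 R1
  swap
  · have h (t : ℝ) : visibleSource R0 R1 κt φ r t x = 0 := if_neg fun h => hx ⟨h.1, h.2.1⟩
    simp [indicator_of_notMem hx, chordKernel, h]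
  rw [indicator_of_mem hx]
  have hx0 : 0 < x := hR0.trans hx.1
  have hq2 : 0 < r ^ 2 - R0 ^ 2 := by nlinarith
  have hy2 : 0 < x ^ 2 - R0 ^ 2 := by nlinarith [hx.1]
  have hqr : √(r ^ 2 - R0 ^ 2) < r := by rw [sqrt_lt' hr0]; nlinarith
  have hyx : √(x ^ 2 - R0 ^ 2) < x := by rw [sqrt_lt' hx0]; nlinarith
  have hle : |r - x| ≤ √(r ^ 2 - R0 ^ 2) + √(x ^ 2 - R0 ^ 2) := by
    have hqq := sq_sqrt hq2.le
    have hyy := sq_sqrt hy2.le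
    have hq0 := sqrt_pos.2 hq2
    have hy0 := sqrt_pos.2 hy2
    rw [abs_le]
    constructor <;> nlinarith
  have hflip := intervalIntegral.integral_comp_neg (a := √(r ^ 2 - R0 ^ 2) + √(x ^ 2 - R0 ^ 2))
    (b := |r - x|) (fun ν => exp (κt * ν) / ν)
  have hset : Ioo |r - x| (√(r ^ 2 - R0 ^ 2) + √(x ^ 2 - R0 ^ 2)) =
      Ioo 0 (R1 + r) ∩ Ioo |r - x| (√(r ^ 2 - R0 ^ 2) + √(x ^ 2 - R0 ^ 2)) := by
    rw [Ioo_inter_Ioo, max_eq_right (abs_nonneg _), min_eq_right (by linarith [hx.2])]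
  rw [← neg_add', ← hflip, intervalIntegral.integral_symm, intervalIntegral.integral_of_le hle,
    integral_Ioc_eq_integral_Ioo, ← integral_neg, ← integral_const_mul, ← integral_const_mul, hset,
    ← setIntegral_indicator measurableSet_Ioo]
  refine setIntegral_congr_fun measurableSet_Ioo fun t ht => ?_
  have ht0 := ht.1
  by_cases hta : t < √(r ^ 2 - R0 ^ 2) + √(x ^ 2 - R0 ^ 2)
  · have hiff : (|r - t| < x ∧ x < r + t) ↔ |r - x| < t := by
      rw [abs_lt, abs_lt]
      constructor
      · rintro ⟨⟨h1, h2⟩, h3⟩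
        constructor <;> linarith
      · rintro ⟨h1, h2⟩
        refine ⟨⟨?_, ?_⟩, ?_⟩ <;> linarith
    simp only [chordKernel, visibleSource, hiff, hx.1, hx.2, hta, indicator_apply, mem_Ioo,
      and_true, if_true]
    split_ifs
    · rw [div_neg, neg_neg, mul_neg, neg_mul]
      field_simp
    · rfl
  · simp [chordKernel, visibleSource, hta]

/-- The total contribution of the source to the direction average, as an integral over radii. -/
lemma integral_direction_kernel {R0 R1 r : ℝ} (κt : ℝ) {φ : ℝ → ℝ} (hR0 : 0 < R0) (hr : R0 < r)
    (hr1 : r < R1) (hφ : ContinuousOn φ (Icc R0 R1)) :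
    ∫ μ in Ioo (-1 : ℝ) 1, ∫ t in Ioo 0 (R1 + r),
      visibleSource R0 R1 κt φ r t (√(t ^ 2 + 2 * (r * μ) * t + r ^ 2)) /
        √(t ^ 2 + 2 * (r * μ) * t + r ^ 2) =
    r⁻¹ * ∫ x in R0..R1, φ x * ∫ ν in (-|r - x|)..
        (-√(r ^ 2 - R0 ^ 2) - √(x ^ 2 - R0 ^ 2)), exp (κt * ν) / ν := by
  have hr0 : 0 < r := hR0.trans hr
  rw [integral_integral_swap (integrable_direction_kernel κt r (R1 + r) hR0 hφ)]
  have hradius : ∀ t ∈ Ioo 0 (R1 + r), ∫ μ in Ioo (-1 : ℝ) 1,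
      visibleSource R0 R1 κt φ r t (√(t ^ 2 + 2 * (r * μ) * t + r ^ 2)) /
        √(t ^ 2 + 2 * (r * μ) * t + r ^ 2) = ∫ x, chordKernel R0 R1 κt φ r t x := by
    intro t ht
    rw [integral_direction_eq_integral_radius _ hr0 ht.1, ← integral_indicator measurableSet_Ioo]
    simp only [indicator_apply, mem_Ioo, chordKernel]
  rw [setIntegral_congr_fun measurableSet_Ioo hradius,
    integral_integral_swap (integrable_chordKernel κt r (R1 + r) hr0 hφ)]
  simp_rw [integral_chordKernel_length κt φ _ hR0 hr hr1]
  rw [integral_indicator measurableSet_Ioo, integral_const_mul,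
    intervalIntegral.integral_of_le (hr.trans hr1).le, integral_Ioc_eq_integral_Ioo]

lemma integral_boundary_indicator {R0 r : ℝ} (κt : ℝ) (hR0 : 0 < R0) (hr : R0 < r) :
    IntegrableOn (fun μ => if μ < mud R0 r
      then exp (κt * (r * μ + √(R0 ^ 2 - r ^ 2 + r ^ 2 * μ ^ 2))) else 0) (Ioo (-1) 1) ∧
    ∫ μ in Ioo (-1 : ℝ) 1, (if μ < mud R0 r
      then exp (κt * (r * μ + √(R0 ^ 2 - r ^ 2 + r ^ 2 * μ ^ 2))) else 0) =
    ∫ μ in (-1 : ℝ)..mud R0 r, exp (κt * (r * μ + √(R0 ^ 2 - r ^ 2 + r ^ 2 * μ ^ 2))) := by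
  have hr0 : 0 < r := hR0.trans hr
  have hmud := mul_mud hR0 hr
  have hq0 := sqrt_nonneg (r ^ 2 - R0 ^ 2)
  have hqr : √(r ^ 2 - R0 ^ 2) < r := by rw [sqrt_lt' hr0]; nlinarith
  have h1 : -1 ≤ mud R0 r := by nlinarith
  have h2 : mud R0 r ≤ 1 := by nlinarith
  have hcont : Continuous fun μ => exp (κt * (r * μ + √(R0 ^ 2 - r ^ 2 + r ^ 2 * μ ^ 2))) := by
    fun_prop
  have heq : (fun μ => if μ < mud R0 r
      then exp (κt * (r * μ + √(R0 ^ 2 - r ^ 2 + r ^ 2 * μ ^ 2))) else 0) =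
      (Iio (mud R0 r)).indicator
        fun μ => exp (κt * (r * μ + √(R0 ^ 2 - r ^ 2 + r ^ 2 * μ ^ 2))) := rfl
  rw [heq]
  refine ⟨((hcont.integrableOn_Icc (a := -1) (b := 1)).mono_set Ioo_subset_Icc_self).indicator
    measurableSet_Iio, ?_⟩
  rw [setIntegral_indicator measurableSet_Iio, Ioo_inter_Iio, min_eq_right h2,
    intervalIntegral.integral_of_le h1, integral_Ioc_eq_integral_Ioo]

/-- The integral equation satisfied by `φ(r) = κ_s r ⟨I⟩(r)` where `I` is the
characteristic-formula solution of the stationary adjoint equation. -/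
theorem integral_equation_for_phi
    (R0 R1 κt κs : ℝ) (hR0 : 0 < R0) (hR01 : R0 < R1)
    (φ : ℝ → ℝ) (hφ : ContinuousOn φ (Icc R0 R1)) :
    ∀ r ∈ Ioo R0 R1,
      (κs * r / 2) * ∫ μ in (-1:ℝ)..1, impFun R0 R1 κt φ r μ
        = (κs / 4) * (∫ θ in (R0 - r)..(-Real.sqrt (r^2 - R0^2)),
            Real.exp (κt * θ) * (1 + (R0^2 - r^2) / θ^2))
          + (κs / 2) * ∫ r' in R0..R1,
              φ r' * (∫ ν in (-|r - r'|)..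
                  (-Real.sqrt (r^2 - R0^2) - Real.sqrt (r'^2 - R0^2)),
                Real.exp (κt * ν) / ν) := by
  intro r hr
  obtain ⟨hr0, hr1⟩ := hr
  have hrpos : 0 < r := hR0.trans hr0
  obtain ⟨hAint, hA⟩ := integral_boundary_indicator κt hR0 hr0
  have hae : ∀ᵐ μ ∂volume.restrict (Ioo (-1 : ℝ) 1), impFun R0 R1 κt φ r μ =
      (if μ < mud R0 r then exp (κt * (r * μ + √(R0 ^ 2 - r ^ 2 + r ^ 2 * μ ^ 2))) else 0) +
      ∫ t in Ioo 0 (R1 + r),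
        visibleSource R0 R1 κt φ r t (√(t ^ 2 + 2 * (r * μ) * t + r ^ 2)) /
          √(t ^ 2 + 2 * (r * μ) * t + r ^ 2) := by
    filter_upwards [ae_restrict_mem measurableSet_Ioo,
      ae_restrict_of_ae (Measure.ae_ne volume (mud R0 r))] with μ hμ hμd
    rw [impFun, integral_characteristic κt φ hR0 hr0 hr1 hμ hμd]
  rw [intervalIntegral.integral_of_le (by norm_num : (-1 : ℝ) ≤ 1), integral_Ioc_eq_integral_Ioo,
    integral_congr_ae hae,
    integral_add hAint (integrable_direction_kernel κt r (R1 + r) hR0 hφ).integral_prod_left,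
    hA, integral_direction_kernel κt hR0 hr0 hr1 hφ]
  have hboundary := integral_boundary_term κt hR0 hr0
  have hsplit : ∀ a b : ℝ, κs * r / 2 * (a + r⁻¹ * b) = κs / 2 * (r * a) + κs / 2 * b := by
    intro a b
    field_simp
  rw [hsplit, hboundary]
  ring
end

section
/- Let 0 < R0 < R1 and κ_t, κ_s ∈ ℝ. Suppose u and I are C¹ functions of (r,μ) ∈ [R0,R1] × [−1,1] satisfying, on (R0,R1) × (−1,1), the stationary transport equation μ ∂_r u + ((1−μ²)/r) ∂_μ u + κ_t u = κ_s ⟨u⟩(r) and the stationary adjoint equation −μ ∂_r I − ((1−μ²)/r) ∂_μ I + κ_t I = κ_s ⟨I⟩(r), where ⟨f⟩(r) = (1/2)∫_{−1}^{1} f(r,μ) dμ. Then the function r ↦ r² ∫_{−1}^{1} μ u(r,μ) I(r,μ) dμ is constant on [R0,R1]. -/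
open Real Set MeasureTheory

/-- The section at `r` of a function continuous on a rectangle is continuous. -/
theorem continuousOn_section_right {a b c d r : ℝ} {g : ℝ → ℝ → ℝ}
    (hg : ContinuousOn (fun p : ℝ × ℝ => g p.1 p.2) (Icc a b ×ˢ Icc c d)) (hr : r ∈ Icc a b) :
    ContinuousOn (g r) (Icc c d) :=
  hg.comp (f := fun m : ℝ => (r, m)) (by fun_prop) fun _ hm => ⟨hr, hm⟩

/-- The integral over one side of a rectangle of a function continuous on the rectangle depends
continuously on the other variable. -/
theorem continuousOn_intervalIntegral_of_continuousOn_prod {a b c d : ℝ} (hab : a ≤ b)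
    (hcd : c ≤ d) {g : ℝ → ℝ → ℝ}
    (hg : ContinuousOn (fun p : ℝ × ℝ => g p.1 p.2) (Icc a b ×ˢ Icc c d)) :
    ContinuousOn (fun r => ∫ m in c..d, g r m) (Icc a b) := by
  have hG : Continuous (Function.uncurry fun r m : ℝ =>
      g (projIcc a b hab r) (projIcc c d hcd m)) :=
    hg.comp_continuous
      (f := fun p : ℝ × ℝ => ((projIcc a b hab p.1 : ℝ), (projIcc c d hcd p.2 : ℝ)))
      (by fun_prop) fun p => ⟨(projIcc a b hab p.1).2, (projIcc c d hcd p.2).2⟩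
  refine (intervalIntegral.continuous_parametric_intervalIntegral_of_continuous' (μ := volume)
    hG c d).continuousOn.congr fun r hr => ?_
  refine intervalIntegral.integral_congr fun m hm => ?_
  rw [uIcc_of_le hcd] at hm
  simp only [projIcc_of_mem hab hr, projIcc_of_mem hcd hm]

/-- Differentiation under the integral sign for a function on a rectangle whose partial
derivative is continuous. -/
theorem hasDerivAt_intervalIntegral_of_continuousOn_prod {a b c d : ℝ} (hcd : c ≤ d)
    {g g' : ℝ → ℝ → ℝ}
    (hg : ContinuousOn (fun p : ℝ × ℝ => g p.1 p.2) (Icc a b ×ˢ Icc c d))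
    (hg' : ContinuousOn (fun p : ℝ × ℝ => g' p.1 p.2) (Icc a b ×ˢ Icc c d))
    (hderiv : ∀ r ∈ Ioo a b, ∀ m ∈ Icc c d, HasDerivAt (fun ρ => g ρ m) (g' r m) r)
    {r : ℝ} (hr : r ∈ Ioo a b) :
    HasDerivAt (fun ρ => ∫ m in c..d, g ρ m) (∫ m in c..d, g' r m) r := by
  obtain ⟨C, hC⟩ := (isCompact_Icc.prod isCompact_Icc).exists_bound_of_continuousOn hg'
  have hsub : uIoc c d ⊆ Icc c d := by
    rw [uIoc_of_le hcd]
    exact Ioc_subset_Icc_self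
  have hint : ∀ {f : ℝ → ℝ → ℝ},
      ContinuousOn (fun p : ℝ × ℝ => f p.1 p.2) (Icc a b ×ˢ Icc c d) →
      ∀ ρ ∈ Ioo a b, IntervalIntegrable (f ρ) volume c d := fun hf ρ hρ =>
    (continuousOn_section_right hf (Ioo_subset_Icc_self hρ)).intervalIntegrable_of_Icc hcd
  have hnhds : Ioo a b ∈ nhds r := Ioo_mem_nhds hr.1 hr.2
  refine (intervalIntegral.hasDerivAt_integral_of_dominated_loc_of_deriv_le
    (bound := fun _ => C) hnhds ?_ (hint hg r hr) ?_ ?_ (by simp) ?_).2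
  · filter_upwards [hnhds] with ρ hρ
    exact (hint hg ρ hρ).def'.aestronglyMeasurable
  · exact (hint hg' r hr).def'.aestronglyMeasurable
  · exact .of_forall fun m hm ρ hρ => hC (ρ, m) ⟨Ioo_subset_Icc_self hρ, hsub hm⟩
  · exact .of_forall fun m hm ρ hρ => hderiv ρ hρ m (hsub hm)

/-- Conservation of the net radial flux of `u·I`: if `u` solves the stationary
spherically symmetric transport equation and `I` the stationary adjoint equation
(isotropic kernel `k = 1/2`), then `r ↦ r² ∫_{−1}^1 μ u(r,μ) I(r,μ) dμ` is constant
on `[R0,R1]`. -/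
theorem radial_flux_of_uI_constant
    (R0 R1 κt κs : ℝ) (hR0 : 0 < R0) (hR01 : R0 < R1)
    (u ur uμ I Ir Iμ : ℝ → ℝ → ℝ)
    (hu_cont : ContinuousOn (fun p : ℝ × ℝ => u p.1 p.2) (Icc R0 R1 ×ˢ Icc (-1) 1))
    (hI_cont : ContinuousOn (fun p : ℝ × ℝ => I p.1 p.2) (Icc R0 R1 ×ˢ Icc (-1) 1))
    (hur_cont : ContinuousOn (fun p : ℝ × ℝ => ur p.1 p.2) (Icc R0 R1 ×ˢ Icc (-1) 1))
    (huμ_cont : ContinuousOn (fun p : ℝ × ℝ => uμ p.1 p.2) (Icc R0 R1 ×ˢ Icc (-1) 1))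
    (hIr_cont : ContinuousOn (fun p : ℝ × ℝ => Ir p.1 p.2) (Icc R0 R1 ×ˢ Icc (-1) 1))
    (hIμ_cont : ContinuousOn (fun p : ℝ × ℝ => Iμ p.1 p.2) (Icc R0 R1 ×ˢ Icc (-1) 1))
    (hur : ∀ r ∈ Ioo R0 R1, ∀ μ ∈ Icc (-1:ℝ) 1,
      HasDerivAt (fun ρ => u ρ μ) (ur r μ) r)
    (huμ : ∀ r ∈ Ioo R0 R1, ∀ μ ∈ Ioo (-1:ℝ) 1,
      HasDerivAt (fun m => u r m) (uμ r μ) μ)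
    (hIr : ∀ r ∈ Ioo R0 R1, ∀ μ ∈ Icc (-1:ℝ) 1,
      HasDerivAt (fun ρ => I ρ μ) (Ir r μ) r)
    (hIμ : ∀ r ∈ Ioo R0 R1, ∀ μ ∈ Ioo (-1:ℝ) 1,
      HasDerivAt (fun m => I r m) (Iμ r μ) μ)
    (hPDE : ∀ r ∈ Ioo R0 R1, ∀ μ ∈ Ioo (-1:ℝ) 1,
      μ * ur r μ + (1 - μ^2)/r * uμ r μ + κt * u r μ
        = κs * ((1:ℝ)/2 * ∫ μ' in (-1:ℝ)..1, u r μ'))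
    (hadj : ∀ r ∈ Ioo R0 R1, ∀ μ ∈ Ioo (-1:ℝ) 1,
      -μ * Ir r μ - (1 - μ^2)/r * Iμ r μ + κt * I r μ
        = κs * ((1:ℝ)/2 * ∫ μ' in (-1:ℝ)..1, I r μ')) :
    ∀ r₁ ∈ Icc R0 R1, ∀ r₂ ∈ Icc R0 R1,
      r₁^2 * ∫ μ in (-1:ℝ)..1, μ * u r₁ μ * I r₁ μ
        = r₂^2 * ∫ μ in (-1:ℝ)..1, μ * u r₂ μ * I r₂ μ := by
  have hflux_cont : ContinuousOn (fun p : ℝ × ℝ => p.2 * u p.1 p.2 * I p.1 p.2)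
      (Icc R0 R1 ×ˢ Icc (-1) 1) := (continuousOn_snd.mul hu_cont).mul hI_cont
  have hflux_cont' : ContinuousOn
      (fun p : ℝ × ℝ => p.2 * ur p.1 p.2 * I p.1 p.2 + p.2 * u p.1 p.2 * Ir p.1 p.2)
      (Icc R0 R1 ×ˢ Icc (-1) 1) :=
    ((continuousOn_snd.mul hur_cont).mul hI_cont).add
      ((continuousOn_snd.mul hu_cont).mul hIr_cont)
  have hcont : ContinuousOn (fun r => r ^ 2 * ∫ μ in (-1 : ℝ)..1, μ * u r μ * I r μ)
      (Icc R0 R1) :=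
    (continuousOn_id.pow 2).mul (continuousOn_intervalIntegral_of_continuousOn_prod
      (g := fun r μ => μ * u r μ * I r μ) hR01.le (by norm_num) hflux_cont)
  have hderiv : ∀ r ∈ Ioo R0 R1,
      HasDerivAt (fun r => r ^ 2 * ∫ μ in (-1 : ℝ)..1, μ * u r μ * I r μ) 0 r := by
    intro r hr
    have hr0 : r ≠ 0 := (hR0.trans hr.1).ne'
    have hr' := Ioo_subset_Icc_self hr
    have hflux := hasDerivAt_intervalIntegral_of_continuousOn_prod
      (g := fun r μ => μ * u r μ * I r μ)
      (g' := fun r μ => μ * ur r μ * I r μ + μ * u r μ * Ir r μ)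
      (by norm_num) hflux_cont hflux_cont'
      (fun ρ hρ μ hμ => ((hur ρ hρ μ hμ).const_mul μ).mul (hIr ρ hρ μ hμ)) hr
    have hu' := continuousOn_section_right hu_cont hr'
    have hI' := continuousOn_section_right hI_cont hr'
    have huμ' := continuousOn_section_right huμ_cont hr'
    have hIμ' := continuousOn_section_right hIμ_cont hr'
    have hle : (-1 : ℝ) ≤ 1 := by norm_num
    have hangular : ∫ μ in (-1 : ℝ)..1, (-(2 * μ) * (u r μ * I r μ)
        + (1 - μ ^ 2) * (uμ r μ * I r μ + u r μ * Iμ r μ)) = 0 := by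
      rw [intervalIntegral.integral_eq_sub_of_hasDerivAt_of_le
        (f := fun μ => (1 - μ ^ 2) * (u r μ * I r μ)) hle (by fun_prop) ?_
        (ContinuousOn.intervalIntegrable_of_Icc hle (by fun_prop))]
      · norm_num
      · intro μ hμ
        have hweight : HasDerivAt (fun μ : ℝ => 1 - μ ^ 2) (-(2 * μ)) μ := by
          simpa using (hasDerivAt_pow 2 μ).const_sub 1
        exact hweight.mul ((huμ r hr μ hμ).mul (hIμ r hr μ hμ))
    have hradial : ∫ μ in (-1 : ℝ)..1, (μ * ur r μ * I r μ + μ * u r μ * Ir r μ)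
        = -(2 / r) * ∫ μ in (-1 : ℝ)..1, μ * u r μ * I r μ := by
      calc
        _ = ∫ μ in (-1 : ℝ)..1, (-(1 / r) * (-(2 * μ) * (u r μ * I r μ)
              + (1 - μ ^ 2) * (uμ r μ * I r μ + u r μ * Iμ r μ))
            - 2 / r * (μ * u r μ * I r μ)
            + (κs * (1 / 2 * ∫ μ' in (-1 : ℝ)..1, u r μ') * I r μ
              - κs * (1 / 2 * ∫ μ' in (-1 : ℝ)..1, I r μ') * u r μ)) := by
          refine intervalIntegral.integral_congr_Ioo_of_le hle fun μ hμ => ?_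
          simp only [← hPDE r hr μ hμ, ← hadj r hr μ hμ]
          ring
        _ = _ := by
          rw [intervalIntegral.integral_add, intervalIntegral.integral_sub,
            intervalIntegral.integral_sub, intervalIntegral.integral_const_mul,
            intervalIntegral.integral_const_mul, intervalIntegral.integral_const_mul,
            intervalIntegral.integral_const_mul, hangular]
          · ring
          all_goals exact ContinuousOn.intervalIntegrable_of_Icc hle (by fun_prop)
    refine ((hasDerivAt_pow 2 r).fun_mul hflux).congr_deriv ?_
    rw [hradial]
    field_simp
    push_cast
    ring
  have hconst : ∀ r ∈ Icc R0 R1, r ^ 2 * ∫ μ in (-1 : ℝ)..1, μ * u r μ * I r μ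
      = R0 ^ 2 * ∫ μ in (-1 : ℝ)..1, μ * u R0 μ * I R0 μ := by
    intro r hr
    have hFTC := intervalIntegral.integral_eq_sub_of_hasDerivAt_of_le (f' := fun _ => 0) hr.1
      (hcont.mono (Icc_subset_Icc_right hr.2))
      (fun x hx => hderiv x (Ioo_subset_Ioo_right hr.2 hx)) (by simp)
    rw [intervalIntegral.integral_zero] at hFTC
    exact sub_eq_zero.mp hFTC.symm
  intro r₁ hr₁ r₂ hr₂
  rw [hconst r₁ hr₁, hconst r₂ hr₂]
end
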